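/- arXiv:2202.06375 — 6 statements merged into one kernel-verified Lean document; each statement's English description precedes it below -/
import Mathlib

section
/- For every i ≥ 0, the set W i is prefix-free: no string in W i is a (not necessarily proper) prefix of a different string in W i. -/
/-- The sets `W i` of binary strings (bits as `Bool`, `false` = 0, `true` = 1):
`W 0 = {"0"}`, `W 1 = W 2 = {"1"}`, `W 3 = {"0","1"}`, `W 4 = {"00","01","1"}`,
`W 5 = {"000","001","01","1"}`, and for `i ≥ 6`,
`W i = 0·W (i-1) ∪ 1·W (i-3)`. -/
def W : ℕ → Finset (List Bool)
  | 0 => {[false]}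
  | 1 => {[true]}
  | 2 => {[true]}
  | 3 => {[false], [true]}
  | 4 => {[false, false], [false, true], [true]}
  | 5 => {[false, false, false], [false, false, true], [false, true], [true]}
  | (n + 6) => (W (n + 5)).image (fun s => false :: s) ∪ (W (n + 3)).image (fun s => true :: s)

/-- For every `i ≥ 0`, the set `W i` is prefix-free: no string in `W i` is a
(not necessarily proper) prefix of a different string in `W i`. -/
theorem W_prefixFree (i : ℕ) :
    ∀ x ∈ W i, ∀ y ∈ W i, x ≠ y → ¬ x <+: y := by
  induction i using W.induct with
  | case7 n ih₅ ih₃ =>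
    intro x hx y hy hne hxy
    simp only [W, Finset.mem_union, Finset.mem_image] at hx hy
    rcases hx with ⟨s, hs, rfl⟩ | ⟨s, hs, rfl⟩ <;> rcases hy with ⟨t, ht, rfl⟩ | ⟨t, ht, rfl⟩ <;>
      simp only [List.cons_prefix_cons, reduceCtorEq, false_and, true_and] at hxy
    · exact ih₅ s hs t ht (fun h => hne (h ▸ rfl)) hxy
    · exact ih₃ s hs t ht (fun h => hne (h ▸ rfl)) hxy
  | _ => simp [W]
end

section
/- For every i ≥ 3 and every string w ∈ W i, C(pre_{|w|-1}(w)) ≤ i - 3, where pre_{|w|-1}(w) is the prefix of w of length |w| - 1 (i.e., w with its last character removed). -/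
/-- `C x` is the number of 0's in `x` plus three times the number of 1's in `x`. -/
def C (x : List Bool) : ℕ := x.count false + 3 * x.count true

theorem C_dropLast_cons_false_le (s : List Bool) :
    C (false :: s).dropLast ≤ C s.dropLast + 1 := by
  cases s <;> simp [C]; lia

theorem C_dropLast_cons_true_le (s : List Bool) :
    C (true :: s).dropLast ≤ C s.dropLast + 3 := by
  cases s <;> simp [C]; lia

/-- For every `i ≥ 3` and every `w ∈ W i`, `C` of the prefix of `w` of length `|w| - 1`
(i.e. `w` with its last character removed) is at most `i - 3`. -/
theorem C_dropLast_le (i : ℕ) (hi : 3 ≤ i) :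
    ∀ w ∈ W i, C w.dropLast ≤ i - 3 := by
  induction i using W.induct with
  | case1 | case2 | case3 => lia
  | case4 | case5 | case6 => decide
  | case7 n ih₁ ih₃ =>
    intro w hw
    simp only [W, Finset.mem_union, Finset.mem_image] at hw
    obtain ⟨s, hs, rfl⟩ | ⟨s, hs, rfl⟩ := hw
    · have h := ih₁ (by lia) s hs
      have := C_dropLast_cons_false_le s
      lia
    · have h := ih₃ (by lia) s hs
      have := C_dropLast_cons_true_le s
      lia
end

section
/- For every i ≥ 0, the cardinality of the set W i equals w i, the i-th term of Narayana's cows sequence. -/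
/-- Narayana's cows sequence: `w 0 = w 1 = w 2 = 1` and `w i = w (i-1) + w (i-3)` for `i ≥ 3`. -/
def narayana : ℕ → ℕ
  | 0 => 1
  | 1 => 1
  | 2 => 1
  | (n + 3) => narayana (n + 2) + narayana n

/-- Prepending distinct bits to two finite sets of strings gives a union whose cardinality is the sum
of the cardinalities. -/
theorem card_image_false_cons_union_image_true_cons (A B : Finset (List Bool)) :
    (A.image (fun s => false :: s) ∪ B.image (fun s => true :: s)).card = A.card + B.card := by
  rw [Finset.card_union_of_disjoint, Finset.card_image_of_injective _ List.cons_injective,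
    Finset.card_image_of_injective _ List.cons_injective]
  simp [Finset.disjoint_left]

/-- For every `i ≥ 0`, the cardinality of `W i` equals the `i`-th term of
Narayana's cows sequence. -/
theorem W_card (i : ℕ) : (W i).card = narayana i := by
  induction i using W.induct with
  | case1 | case2 | case3 | case4 | case5 | case6 => decide
  | case7 n ih₁ ih₂ =>
    rw [W, card_image_false_cons_union_image_true_cons, ih₁, ih₂, ← narayana]
end

section
/- If c : ℝ satisfies c³ = c² + 1 and d : ℝ satisfies 31d³ - 31d² + 9d = 1, then for every i ≥ 0, w i = ⌊d·c^i + 1/2⌋ (as integers). -/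
/-- Numerical bounds for the real root of `x³ - x² - 1`. -/
theorem narayana_root_bounds {c : ℝ} (hc : c ^ 3 = c ^ 2 + 1) : 1.465 < c ∧ c < 1.466 := by
  constructor
  · by_contra! h
    nlinarith [mul_nonneg (sub_nonneg.2 h) (sq_nonneg (c + 0.2325)), sq_nonneg (c + 0.2325)]
  · by_contra! h
    nlinarith [mul_nonneg (sub_nonneg.2 h) (sq_nonneg (c + 0.233)), sq_nonneg (c + 0.233)]

/-- The leading coefficient is determined by the root `c`: `d = c / (3c - 2)`. -/
theorem narayana_coeff_eq {c d : ℝ} (hc : c ^ 3 = c ^ 2 + 1)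
    (hd : 31 * d ^ 3 - 31 * d ^ 2 + 9 * d = 1) : d = c / (3 * c - 2) := by
  obtain ⟨h1, h2⟩ := narayana_root_bounds hc
  have hpos : 0 < 3 * c - 2 := by linarith
  obtain ⟨r, hr⟩ : ∃ r, r = c / (3 * c - 2) := ⟨_, rfl⟩
  have hr3 : 31 * r ^ 3 - 31 * r ^ 2 + 9 * r = 1 := by
    have hne : 3 * c - 2 ≠ 0 := hpos.ne'
    have hrc : r * (3 * c - 2) = c := by rw [hr, div_mul_cancel₀ _ hne]
    apply mul_left_cancel₀ (pow_ne_zero 3 hne)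
    linear_combination (-8) * hc + (31 * ((r * (3 * c - 2)) ^ 2 + r * (3 * c - 2) * c + c ^ 2)
      - 31 * (3 * c - 2) * (r * (3 * c - 2) + c) + 9 * (3 * c - 2) ^ 2) * hrc
  have hr1 : 0.61 < r := by rw [hr, lt_div_iff₀ hpos]; linarith
  have hr2 : r < 0.613 := by rw [hr, div_lt_iff₀ hpos]; linarith
  have hfac : (d - r) * (31 * (d ^ 2 + d * r + r ^ 2) - 31 * (d + r) + 9) = 0 := by
    linear_combination hd - hr3
  rw [← hr]
  rcases mul_eq_zero.1 hfac with h | h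
  · linarith
  · nlinarith [sq_nonneg (2 * d + r - 1), mul_pos (sub_pos.2 hr1) (sub_pos.2 hr2)]

/-- The error `w n - d c ^ n` satisfies the recurrence of the complementary quadratic factor
`x² + (c - 1) x + c (c - 1)` of `x³ - x² - 1`. -/
theorem narayana_error_recurrence {c d : ℝ} (hc : c ^ 3 = c ^ 2 + 1)
    (hdc : d * (3 * c - 2) = c) (n : ℕ) :
    (narayana (n + 2) - d * c ^ (n + 2)) + (c - 1) * (narayana (n + 1) - d * c ^ (n + 1))
      + c * (c - 1) * (narayana n - d * c ^ n) = 0 := by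
  induction n with
  | zero =>
    simp only [narayana, Nat.cast_one]
    linear_combination (-c) * hdc
  | succ n ih =>
    have hw : (narayana (n + 1 + 2) : ℝ) = narayana (n + 2) + narayana n := by
      simp [narayana]
    rw [hw, show n + 1 + 1 = n + 2 from rfl]
    linear_combination c * ih + (-(narayana n : ℝ)) * hc

/-- A positive definite quadratic form, contracted by the recurrence, controls the error. -/
theorem narayana_error_form_le {c d : ℝ} (hc : c ^ 3 = c ^ 2 + 1)
    (hdc : d * (3 * c - 2) = c) (n : ℕ) :
    (narayana (n + 1) - d * c ^ (n + 1)) ^ 2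
      + (c - 1) * (narayana n - d * c ^ n) * (narayana (n + 1) - d * c ^ (n + 1))
      + c * (c - 1) * (narayana n - d * c ^ n) ^ 2 ≤ 0.14 := by
  obtain ⟨h1, h2⟩ := narayana_root_bounds hc
  induction n with
  | zero =>
    have hd1 : 0.611 < d := by nlinarith
    have hd2 : d < 0.612 := by nlinarith
    have hdc1 : 0.895 < d * c := by nlinarith
    have hdc2 : d * c < 0.898 := by nlinarith
    simp only [narayana, Nat.cast_one, pow_zero, mul_one, zero_add, pow_one]
    have hq : c * (c - 1) ≤ 0.684 := by nlinarith
    have ha : (1 - d * c) ^ 2 ≤ 0.105 ^ 2 := by gcongr <;> linarith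
    have hb : (c - 1) * (1 - d) * (1 - d * c) ≤ 0.466 * 0.389 * 0.105 := by
      gcongr <;> nlinarith
    have he : c * (c - 1) * (1 - d) ^ 2 ≤ 0.684 * 0.389 ^ 2 := by
      gcongr <;> linarith
    norm_num at *
    linarith
  | succ n ih =>
    have hrec := narayana_error_recurrence hc hdc n
    rw [show n + 1 + 1 = n + 2 from rfl]
    generalize (narayana (n + 2) : ℝ) - d * c ^ (n + 2) = z at *
    generalize (narayana (n + 1) : ℝ) - d * c ^ (n + 1) = y at *
    generalize (narayana n : ℝ) - d * c ^ n = x at *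
    have hq0 : 0 ≤ c * (c - 1) := by nlinarith
    have hq1 : c * (c - 1) ≤ 1 := by nlinarith
    have hz : z ^ 2 + (c - 1) * y * z + c * (c - 1) * y ^ 2
        = c * (c - 1) * (y ^ 2 + (c - 1) * x * y + c * (c - 1) * x ^ 2) := by
      linear_combination (z - c * (c - 1) * x) * hrec
    rw [hz]
    nlinarith [mul_le_mul_of_nonneg_left ih hq0]

/-- If `c³ = c² + 1` (so `c` is the real root of `x³ - x² - 1`) and
`31d³ - 31d² + 9d = 1` (so `d` is the real root of `31x³ - 31x² + 9x - 1`),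
then for every `i ≥ 0`, `w i = ⌊d·c^i + 1/2⌋`. -/
theorem narayana_closed_form (c d : ℝ) (hc : c ^ 3 = c ^ 2 + 1)
    (hd : 31 * d ^ 3 - 31 * d ^ 2 + 9 * d = 1) (i : ℕ) :
    (narayana i : ℤ) = ⌊d * c ^ i + 1 / 2⌋ := by
  
  obtain ⟨h1, h2⟩ := narayana_root_bounds hc
  have hdc : d * (3 * c - 2) = c := by
    rw [narayana_coeff_eq hc hd]
    exact div_mul_cancel₀ _ (by linarith)
  have hQ := narayana_error_form_le hc hdc i
  have hsq : ((narayana i : ℝ) - d * c ^ i) ^ 2 < (1 / 2) ^ 2 := by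
    generalize (narayana (i + 1) : ℝ) - d * c ^ (i + 1) = y at *
    generalize (narayana i : ℝ) - d * c ^ i = x at *
    have hdisc : 0.6 ≤ c * (c - 1) - (c - 1) ^ 2 / 4 := by nlinarith
    nlinarith [sq_nonneg (y + (c - 1) / 2 * x), mul_le_mul_of_nonneg_right hdisc (sq_nonneg x)]
  obtain ⟨hlo, hhi⟩ := abs_lt_of_sq_lt_sq' hsq (by norm_num)
  rw [eq_comm, Int.floor_eq_iff]
  push_cast
  constructor <;> linarith
end

section
/- For every integer m ≥ 2, the smallest index r with w r ≥ m satisfies r ≤ 2·⌈log₂ m⌉ + 2. -/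
theorem narayana_le_succ : ∀ n, narayana n ≤ narayana (n + 1)
  | 0 | 1 => by simp [narayana]
  | n + 2 => by simp [narayana]

theorem two_mul_narayana_le (n : ℕ) : 2 * narayana (n + 2) ≤ narayana (n + 4) := by
  have h₃ : narayana (n + 3) = narayana (n + 2) + narayana n := by rw [narayana]
  have h₄ : narayana (n + 4) = narayana (n + 3) + narayana (n + 1) := by rw [narayana]
  have h₂ : narayana (n + 2) ≤ narayana (n + 1) + narayana n := by
    cases n with
    | zero => simp [narayana]
    | succ k =>
      have h : narayana (k + 1 + 2) = narayana (k + 1 + 1) + narayana k := by rw [narayana]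
      have := narayana_le_succ k
      omega
  omega

theorem two_pow_le_narayana (k : ℕ) : 2 ^ k ≤ narayana (2 * k + 2) := by
  induction k with
  | zero => simp [narayana]
  | succ k ih =>
    have h : 2 * narayana (2 * k + 2) ≤ narayana (2 * (k + 1) + 2) := two_mul_narayana_le (2 * k)
    rw [pow_succ]
    omega

/-- For every integer `m ≥ 2`, the smallest index `r` with `w r ≥ m` satisfies
`r ≤ 2·⌈log₂ m⌉ + 2`. -/
theorem narayana_least_index_le (m : ℕ) (hm : 2 ≤ m) (r : ℕ)
    (hr : IsLeast {i : ℕ | m ≤ narayana i} r) :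
    r ≤ 2 * Nat.clog 2 m + 2 := by
  exact hr.2 ((Nat.le_pow_clog one_lt_two m).trans (two_pow_le_narayana _))
end

section
/- For every i ≥ 1, the set W' i is prefix-free: no string in W' i is a (not necessarily proper) prefix of a different string in W' i. -/
/-- The sets `W' i` of binary strings (bits as `Bool`, `false` = 0, `true` = 1):
`W' 1 = {"0"}`, `W' 2 = {"1"}`, `W' 3 = {"0","1"}`, `W' 4 = {"00","01","1"}`,
and for `i ≥ 5`, `W' i = 0·W' (i-1) ∪ 1·W' (i-2)`.  (`W' 0` is irrelevant and
set to `∅`.) -/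
def W' : ℕ → Finset (List Bool)
  | 0 => ∅
  | 1 => {[false]}
  | 2 => {[true]}
  | 3 => {[false], [true]}
  | 4 => {[false, false], [false, true], [true]}
  | (n + 5) => (W' (n + 4)).image (fun s => false :: s) ∪ (W' (n + 3)).image (fun s => true :: s)

/-- For every `i ≥ 1`, the set `W' i` is prefix-free: no string in `W' i` is a
(not necessarily proper) prefix of a different string in `W' i`. -/
theorem W'_prefixFree (i : ℕ) (hi : 1 ≤ i) :
    ∀ x ∈ W' i, ∀ y ∈ W' i, x ≠ y → ¬ x <+: y := by
  fun_induction W' i with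
  | case1 => omega
  | case2 => simp
  | case3 => simp
  | case4 => simp
  | case5 => simp
  | case6 n ih₀ ih₁ =>
    simp only [Finset.mem_union, Finset.mem_image]
    rintro _ (⟨s, hs, rfl⟩ | ⟨s, hs, rfl⟩) _ (⟨t, ht, rfl⟩ | ⟨t, ht, rfl⟩) hne hpre
    · exact ih₀ (by omega) s hs t ht (by simpa using hne) (by simpa using hpre)
    · simp at hpre
    · simp at hpre
    · exact ih₁ (by omega) s hs t ht (by simpa using hne) (by simpa using hpre)
end
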